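/- There is no Clifford-like parallelism ∥ whose automorphism group properly contains that of ∥ℓ: if every semilinear bijection of H preserving ∥ℓ also preserves ∥, then conversely every semilinear bijection of H preserving ∥ also preserves ∥ℓ (so the two groups coincide). -/

import Mathlib

variable (F H : Type*) [Field F] [DivisionRing H] [Algebra F H]

/-- A *line* of the projective space `ℙ(H_F)`: a 2-dimensional `F`-subspace of `H`. -/
abbrev Line := {M : Submodule F H // Module.finrank F M = 2}

/-- `M ∥ℓ N` : there is `g ≠ 0` with `N = g·M`. -/
def LeftPar (M N : Submodule F H) : Prop :=
  ∃ g : H, g ≠ 0 ∧ (N : Set H) = (fun m => g * m) '' (M : Set H)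

/-- `M ∥r N` : there is `g ≠ 0` with `N = M·g`. -/
def RightPar (M N : Submodule F H) : Prop :=
  ∃ g : H, g ≠ 0 ∧ (N : Set H) = (fun m => m * g) '' (M : Set H)

/-- The left parallel class `Sℓ(M) = {N | N ∥ℓ M}`. -/
def leftClass (M : Line F H) : Set (Line F H) := {N | LeftPar F H N.1 M.1}

/-- The right parallel class `Sr(M) = {N | N ∥r M}`. -/
def rightClass (M : Line F H) : Set (Line F H) := {N | RightPar F H N.1 M.1}

/-- The `∥`-class `S(M) = {N | N ∥ M}`. -/
def parClass (par : Line F H → Line F H → Prop) (M : Line F H) : Set (Line F H) :=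
  {N | par N M}

/-- A parallelism: an equivalence relation on lines such that for every `x ≠ 0`
and every line `M` there is exactly one line `N` with `x ∈ N` and `N ∥ M`. -/
def IsParallelism (par : Line F H → Line F H → Prop) : Prop :=
  Equivalence par ∧
    ∀ x : H, x ≠ 0 → ∀ M : Line F H, ∃! N : Line F H, x ∈ N.1 ∧ par N M

/-- A Clifford-like parallelism: every `∥`-class is a left or a right parallel class. -/
def IsCliffordLike (par : Line F H → Line F H → Prop) : Prop :=
  IsParallelism F H par ∧
    ∀ M : Line F H,
      parClass F H par M = leftClass F H M ∨ parClass F H par M = rightClass F H M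

/-- The star `𝒜` of lines through `F·1`, i.e. the lines containing `1`. -/
def starLines : Set (Line F H) := {L | (1 : H) ∈ L.1}

/-- The set `ℱ` of lines of `𝒜` whose `∥`-class is a left parallel class. -/
def calF (par : Line F H → Line F H → Prop) : Set (Line F H) :=
  {L | (1 : H) ∈ L.1 ∧ parClass F H par L = leftClass F H L}

/-- A semilinear bijection of `H` (over some field automorphism of `F`). -/
def IsSemilinear (β : H → H) : Prop :=
  Function.Bijective β ∧ (∀ x y : H, β (x + y) = β x + β y) ∧
    ∃ σ : F ≃+* F, ∀ (a : F) (x : H), β (a • x) = σ a • β x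

/-- `β` preserves the parallelism `par`: for all lines `M, N`,
`M ∥ N ↔ β(M) ∥ β(N)`, where `β(M)` denotes the line whose carrier is `β '' M`. -/
def Preserves (β : H → H) (par : Line F H → Line F H → Prop) : Prop :=
  ∀ M N M' N' : Line F H,
    (M'.1 : Set H) = β '' (M.1 : Set H) →
    (N'.1 : Set H) = β '' (N.1 : Set H) →
    (par M N ↔ par M' N')

/-- The image `β(𝒢)` of a set of lines under `β`. -/
def imageLines (β : H → H) (G : Set (Line F H)) : Set (Line F H) :=
  {L' | ∃ L ∈ G, (L'.1 : Set H) = β '' (L.1 : Set H)}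

/-- The centre of `H` is exactly `F·1`. -/
def CenterEqF : Prop :=
  ∀ z : H, (∀ x : H, z * x = x * z) ↔ ∃ a : F, z = algebraMap F H a

/-- Ring automorphism of `H`, as a plain function. -/
def IsRingAutFn (α : H → H) : Prop :=
  Function.Bijective α ∧ (∀ x y : H, α (x + y) = α x + α y) ∧ α 1 = 1 ∧
    ∀ x y : H, α (x * y) = α x * α y

/-- Ring antiautomorphism of `H`, as a plain function. -/
def IsRingAntiAutFn (α : H → H) : Prop :=
  Function.Bijective α ∧ (∀ x y : H, α (x + y) = α x + α y) ∧ α 1 = 1 ∧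
    ∀ x y : H, α (x * y) = α y * α x

section Quaternion

variable {F H}

/-- A quaternion skew field is not commutative, so scalars do not exhaust it. -/
lemma exists_not_scalar (hdim : Module.finrank F H = 4) : ∃ x : H, ∀ a : F, x ≠ a • (1 : H) := by
  by_contra! h
  have : Module.finrank F H = 1 :=
    (finrank_eq_one_iff_of_nonzero' (1 : H) one_ne_zero).2 fun x => by
      obtain ⟨a, ha⟩ := h x
      exact ⟨a, ha.symm⟩
  omega

lemma scalar_of_central (hcenter : CenterEqF F H) {z : H} (h : ∀ x, z * x = x * z) :
    ∃ a : F, z = a • (1 : H) := by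
  obtain ⟨a, ha⟩ := (hcenter z).1 h
  exact ⟨a, by rw [ha, Algebra.algebraMap_eq_smul_one]⟩

lemma infinite_of_quaternion (hcenter : CenterEqF F H) (hdim : Module.finrank F H = 4) :
    Infinite F := by
  by_contra hF
  have : Finite F := not_infinite_iff_finite.1 hF
  have : Module.Finite F H := Module.finite_of_finrank_pos (by omega)
  have : Finite H := Module.finite_of_finite F
  obtain ⟨x, hx⟩ := exists_not_scalar (F := F) (H := H) hdim
  obtain ⟨a, ha⟩ := scalar_of_central hcenter
    fun y => (Finite.isDomain_to_isField H).mul_comm x y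
  exact hx a ha

lemma coeff_eq_of_not_scalar {x : H} (hx : ∀ a : F, x ≠ a • (1 : H)) {a b : F}
    (h : a • x = b • (1 : H)) : a = 0 := by
  by_contra ha
  apply hx (a⁻¹ * b)
  rw [mul_smul, ← h, inv_smul_smul₀ ha]

/-- The centralizer of `x` has dimension at most two unless `x` is central. -/
lemma central_of_linearIndependent_sq (hdim : Module.finrank F H = 4) {x : H}
    (h : LinearIndependent F ![1, x, x * x]) (y : H) : x * y = y * x := by
  have : Module.Finite F H := Module.finite_of_finrank_pos (by omega)
  by_cases hy : y = 0
  · simp [hy]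
  let C : Submodule F H := Subalgebra.toSubmodule (Subalgebra.centralizer F {x})
  have hC : ∀ z, z ∈ C ↔ x * z = z * x := fun z => by
    simp [C, Subalgebra.mem_centralizer_iff]
  have h3 : 3 ≤ Module.finrank F C := by
    have hspan := finrank_span_eq_card h
    rw [Fintype.card_fin] at hspan
    refine hspan.symm.le.trans (Submodule.finrank_mono ?_)
    rw [Submodule.span_le]
    rintro _ ⟨i, rfl⟩
    fin_cases i <;> simp [hC, mul_assoc]
  have hmap : Module.finrank F (C.map (LinearMap.mulLeft F y)) = Module.finrank F C :=
    LinearEquiv.finrank_eq (Submodule.equivMapOfInjective _ (mul_right_injective₀ hy) C) |>.symm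
  have hsum := Submodule.finrank_sup_add_finrank_inf_eq C (C.map (LinearMap.mulLeft F y))
  have hle := Submodule.finrank_le (C ⊔ C.map (LinearMap.mulLeft F y))
  have hne : C ⊓ C.map (LinearMap.mulLeft F y) ≠ ⊥ := fun h0 => by
    rw [h0, finrank_bot] at hsum
    omega
  obtain ⟨_, ⟨hz, c, hc, rfl⟩, hz0⟩ := Submodule.exists_mem_ne_zero_of_ne_bot hne
  simp only [LinearMap.mulLeft_apply] at hz hz0
  have hc' := (hC c).1 hc
  have hz' := (hC _).1 hz
  have hc0 : c ≠ 0 := right_ne_zero_of_mul hz0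
  apply mul_right_cancel₀ hc0
  rw [mul_assoc, hz', mul_assoc, mul_assoc, hc']

/-- `t` is the reduced trace of `x`. -/
def IsReducedTrace (x : H) (t : F) : Prop :=
  (∃ n : F, x * x = t • x - n • (1 : H)) ∧ ∀ s : F, x = s • (1 : H) → t = 2 * s

lemma IsReducedTrace.scalar (s : F) : IsReducedTrace (s • (1 : H)) (2 * s) := by
  refine ⟨⟨s * s, ?_⟩, fun s' h => ?_⟩
  · simp only [Algebra.smul_mul_assoc, one_mul]
    module
  · rw [smul_left_injective F (one_ne_zero (α := H)) h]

lemma isReducedTrace_of_not_scalar {x : H} (hx : ∀ a : F, x ≠ a • (1 : H)) {t n : F}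
    (h : x * x = t • x - n • (1 : H)) : IsReducedTrace x t :=
  ⟨⟨n, h⟩, fun s hs => absurd hs (hx s)⟩

lemma IsReducedTrace.unique {x : H} {t t' : F} (h : IsReducedTrace x t)
    (h' : IsReducedTrace x t') : t = t' := by
  by_cases hx : ∃ s : F, x = s • (1 : H)
  · obtain ⟨s, hs⟩ := hx
    rw [h.2 s hs, h'.2 s hs]
  · push Not at hx
    obtain ⟨n, hn⟩ := h.1
    obtain ⟨n', hn'⟩ := h'.1
    refine sub_eq_zero.1 (coeff_eq_of_not_scalar hx (a := t - t') (b := n - n') ?_)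
    have := hn.symm.trans hn'
    linear_combination (norm := module) this

lemma exists_isReducedTrace (hcenter : CenterEqF F H) (hdim : Module.finrank F H = 4) (x : H) :
    ∃ t : F, IsReducedTrace x t := by
  by_cases hx : ∃ s : F, x = s • (1 : H)
  · obtain ⟨s, rfl⟩ := hx
    exact ⟨_, IsReducedTrace.scalar s⟩
  · push Not at hx
    have hli : ¬ LinearIndependent F ![1, x, x * x] := fun h => by
      obtain ⟨a, ha⟩ := scalar_of_central hcenter (central_of_linearIndependent_sq hdim h)
      exact hx a ha
    rw [Fintype.not_linearIndependent_iff] at hli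
    obtain ⟨g, hg, i, hi⟩ := hli
    simp only [Fin.sum_univ_three, Matrix.cons_val] at hg
    have h2 : g 2 ≠ 0 := fun h2 => by
      have h1 : g 1 = 0 := coeff_eq_of_not_scalar hx (b := - g 0) (by
        rw [h2] at hg
        linear_combination (norm := module) hg)
      have h0 : g 0 = 0 := by simpa [h1, h2] using hg
      fin_cases i <;> simp_all
    refine ⟨-(g 2)⁻¹ * g 1, isReducedTrace_of_not_scalar hx (n := (g 2)⁻¹ * g 0) ?_⟩
    apply smul_right_injective H h2
    simp only [smul_sub, smul_smul]
    rw [mul_inv_cancel_left₀ h2, neg_mul, mul_neg, mul_inv_cancel_left₀ h2]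
    linear_combination (norm := module) hg

lemma IsReducedTrace.scalar_add {x : H} {t : F} (h : IsReducedTrace x t) (s : F) :
    IsReducedTrace (s • (1 : H) + x) (2 * s + t) := by
  obtain ⟨⟨n, hn⟩, h2⟩ := h
  refine ⟨⟨s * s + s * t + n, ?_⟩, fun a ha => ?_⟩
  · simp only [mul_add, add_mul, Algebra.smul_mul_assoc, Algebra.mul_smul_comm, one_mul, mul_one,
      hn]
    module
  · rw [h2 (a - s) (by rw [sub_smul, ← ha]; abel)]
    ring

lemma IsReducedTrace.smul {x : H} {t : F} (h : IsReducedTrace x t) (c : F) :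
    IsReducedTrace (c • x) (c * t) := by
  obtain ⟨⟨n, hn⟩, h2⟩ := h
  refine ⟨⟨c * c * n, ?_⟩, fun a ha => ?_⟩
  · simp only [Algebra.smul_mul_assoc, Algebra.mul_smul_comm, hn]
    module
  · by_cases hc : c = 0
    · have : a • (1 : H) = (0 : F) • 1 := by rw [← ha, hc, zero_smul, zero_smul]
      rw [smul_left_injective F (one_ne_zero (α := H)) this, hc]
      ring
    · rw [h2 (c⁻¹ * a) (by rw [mul_smul, ← ha, inv_smul_smul₀ hc])]
      field_simp

lemma IsReducedTrace.add (hcenter : CenterEqF F H) (hdim : Module.finrank F H = 4) {x y : H}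
    {t u : F} (hx : IsReducedTrace x t) (hy : IsReducedTrace y u) :
    IsReducedTrace (x + y) (t + u) := by
  by_cases hxs : ∃ s : F, x = s • (1 : H)
  · obtain ⟨s, rfl⟩ := hxs
    rw [hx.unique (IsReducedTrace.scalar s)]
    exact hy.scalar_add s
  push Not at hxs
  by_cases hys : ∃ a b : F, y = a • (1 : H) + b • x
  · obtain ⟨a, b, rfl⟩ := hys
    rw [hy.unique ((hx.smul b).scalar_add a)]
    convert (hx.smul (1 + b)).scalar_add a using 1
    · module
    · ring
  push Not at hys
  have hind : ∀ a b c : F, a • x + b • y = c • (1 : H) → a = 0 ∧ b = 0 := fun a b c h => by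
    have hb : b = 0 := by
      by_contra hb
      refine hys (b⁻¹ * c) (-(b⁻¹ * a)) ?_
      apply smul_right_injective H hb
      simp only [smul_add, smul_smul, mul_neg, mul_inv_cancel_left₀ hb]
      linear_combination (norm := module) h
    refine ⟨coeff_eq_of_not_scalar hxs (b := c) ?_, hb⟩
    simpa [hb] using h
  have := infinite_of_quaternion hcenter hdim
  obtain ⟨c, hc⟩ := ({0, 1} : Set F).toFinite.exists_notMem
  simp only [Set.mem_insert_iff, Set.mem_singleton_iff, not_or] at hc
  obtain ⟨T, hT⟩ := exists_isReducedTrace hcenter hdim (x + y)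
  obtain ⟨S, hS⟩ := exists_isReducedTrace hcenter hdim (x + c • y)
  suffices hTtu : T = t + u from hTtu ▸ hT
  obtain ⟨⟨n, hn⟩, -⟩ := hx
  obtain ⟨⟨m, hm⟩, -⟩ := hy
  obtain ⟨⟨N, hN⟩, -⟩ := hT
  obtain ⟨⟨M, hM⟩, -⟩ := hS
  simp only [mul_add, add_mul, Algebra.smul_mul_assoc, Algebra.mul_smul_comm, hn, hm] at hN hM
  obtain ⟨h1, h2⟩ := hind (S - c * T - (1 - c) * t) (c * S - c * T - (c * c - c) * u)
    (M - c * N - n + c * n - c * c * m + c * m) (by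
      linear_combination (norm := module) c • hN - hM)
  have h3 : S - T - (c - 1) * u = 0 := by
    apply (mul_eq_zero.1 (_ : c * (S - T - (c - 1) * u) = 0)).resolve_left hc.1
    linear_combination h2
  have h4 : (1 - c) * (T - (t + u)) = 0 := by linear_combination h1 - h3
  exact sub_eq_zero.1 ((mul_eq_zero.1 h4).resolve_left (sub_ne_zero.2 (Ne.symm hc.2)))

/-- The conjugation of a quaternion skew field. -/
theorem exists_conjugation (hcenter : CenterEqF F H) (hdim : Module.finrank F H = 4) :
    ∃ κ : H → H, Function.Involutive κ ∧ (∀ x y, κ (x + y) = κ x + κ y) ∧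
      (∀ (a : F) x, κ (a • x) = a • κ x) ∧ (∀ x y, κ (x * y) = κ y * κ x) ∧
      ∀ x, ∃ t : F, κ x = t • (1 : H) - x := by
  choose tr htr using exists_isReducedTrace (F := F) (H := H) hcenter hdim
  have tr_eq : ∀ {x t}, IsReducedTrace x t → tr x = t := fun h => (htr _).unique h
  have hadd : ∀ x y, tr (x + y) = tr x + tr y := fun x y =>
    tr_eq ((htr x).add hcenter hdim (htr y))
  have hsmul : ∀ (a : F) x, tr (a • x) = a * tr x := fun a x => tr_eq ((htr x).smul a)
  obtain ⟨κ, hκ⟩ : ∃ κ : H → H, ∀ x, κ x = tr x • (1 : H) - x := ⟨_, fun _ => rfl⟩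
  have hinv : Function.Involutive κ := fun x => by
    have h : tr (κ x) = tr x := by
      have := tr_eq (((htr x).smul (-1)).scalar_add (tr x))
      rw [hκ, sub_eq_add_neg, ← neg_one_smul F x, this]
      ring
    rw [hκ, h, hκ, sub_sub_cancel]
  have hκsmul : ∀ (a : F) x, κ (a • x) = a • κ x := fun a x => by
    rw [hκ, hκ, hsmul]
    module
  have hnorm : ∀ x, ∃ n : F, x * κ x = n • (1 : H) := fun x => by
    obtain ⟨n, hn⟩ := (htr x).1
    refine ⟨n, ?_⟩
    rw [hκ, mul_sub, hn, Algebra.mul_smul_comm, mul_one]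
    abel
  refine ⟨κ, hinv, fun x y => ?_, hκsmul, fun x y => ?_, fun x => ⟨_, hκ x⟩⟩
  · rw [hκ, hκ, hκ, hadd]
    module
  obtain ⟨n, hn⟩ := (htr x).1
  obtain ⟨m, hm⟩ := (htr y).1
  obtain ⟨N, hN⟩ := (htr (x + y)).1
  rw [hadd] at hN
  simp only [mul_add, add_mul, hn, hm] at hN
  obtain ⟨T, hT⟩ : ∃ T : F, x * y + κ y * κ x = T • (1 : H) := by
    refine ⟨tr x * tr y + n + m - N, ?_⟩
    simp only [hκ, mul_sub, sub_mul, Algebra.smul_mul_assoc, Algebra.mul_smul_comm, one_mul,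
      mul_one]
    linear_combination (norm := module) hN
  obtain ⟨p, hp⟩ := hnorm x
  obtain ⟨q, hq⟩ := hnorm y
  have htrxy : tr (x * y) = T := by
    refine tr_eq ⟨⟨p * q, ?_⟩, fun s hs => ?_⟩
    · have h1 : x * y * (κ y * κ x) = (p * q) • (1 : H) := by
        rw [mul_assoc, ← mul_assoc y, hq, Algebra.smul_mul_assoc, one_mul, Algebra.mul_smul_comm,
          hp, smul_smul, mul_comm]
      rw [← h1, ← sub_eq_iff_eq_add'.2 hT.symm, mul_sub, Algebra.mul_smul_comm, mul_one]
      abel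
    · suffices h : κ y * κ x = s • (1 : H) by
        rw [hs, h, ← add_smul] at hT
        rw [← smul_left_injective F (one_ne_zero (α := H)) hT]
        ring
      by_cases hx : x = 0
      · have h0 : κ x = 0 := by simpa [hx] using hκsmul 0 0
        rw [h0, mul_zero, ← hs, hx, zero_mul]
      · have hp0 : p ≠ 0 := fun h => by
          rw [h, zero_smul] at hp
          have hx0 := (mul_eq_zero.1 hp).resolve_left hx
          have := hinv x
          rw [hx0] at this
          exact hx (by rw [← this]; simpa using hκsmul 0 0)
        have hy : y = (s * p⁻¹) • κ x := by
          apply mul_left_cancel₀ hx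
          rw [hs, Algebra.mul_smul_comm, hp, smul_smul, inv_mul_cancel_right₀ hp0]
        rw [hy, hκsmul, hinv, Algebra.smul_mul_assoc, hp, smul_smul, inv_mul_cancel_right₀ hp0]
  rw [hκ, htrxy, ← hT]
  abel

lemma linearIndependent_one_pair {x : H} (hxs : ∀ a : F, x ≠ a • (1 : H)) :
    LinearIndependent F ![(1 : H), x] := by
  rw [LinearIndependent.pair_iff]
  intro a b h
  have hb : b = 0 := coeff_eq_of_not_scalar hxs (b := -a) (by
    linear_combination (norm := module) h)
  exact ⟨by simpa [hb] using h, hb⟩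

lemma mem_line_iff {L : Line F H} (h1 : (1 : H) ∈ L.1) {x : H} (hx : x ∈ L.1)
    (hxs : ∀ a : F, x ≠ a • (1 : H)) (y : H) : y ∈ L.1 ↔ ∃ a b : F, a • (1 : H) + b • x = y := by
  have : Module.Finite F L.1 := Module.finite_of_finrank_pos (by rw [L.2]; norm_num)
  have hspan : Submodule.span F {1, x} = L.1 := by
    apply Submodule.eq_of_le_of_finrank_eq
    · rw [Submodule.span_le]
      rintro _ (rfl | rfl)
      exacts [h1, hx]
    · have := finrank_span_eq_card (linearIndependent_one_pair hxs)
      rw [Matrix.range_cons_cons_empty] at this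
      rw [this, L.2, Fintype.card_fin]
  rw [← hspan, Submodule.mem_span_pair]

lemma exists_line_of_not_scalar {x : H} (hxs : ∀ a : F, x ≠ a • (1 : H)) :
    ∃ L : Line F H, (1 : H) ∈ L.1 ∧ x ∈ L.1 := by
  have := finrank_span_eq_card (linearIndependent_one_pair hxs)
  rw [Matrix.range_cons_cons_empty, Fintype.card_fin] at this
  exact ⟨⟨_, this⟩, Submodule.subset_span (by simp), Submodule.subset_span (by simp)⟩

lemma exists_line_one_mem (hdim : Module.finrank F H = 4) (x : H) :
    ∃ L : Line F H, (1 : H) ∈ L.1 ∧ x ∈ L.1 := by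
  by_cases hx : ∃ s : F, x = s • (1 : H)
  · obtain ⟨s, rfl⟩ := hx
    obtain ⟨y, hy⟩ := exists_not_scalar (F := F) (H := H) hdim
    obtain ⟨L, h1, -⟩ := exists_line_of_not_scalar hy
    exact ⟨L, h1, L.1.smul_mem s h1⟩
  · push Not at hx
    exact exists_line_of_not_scalar hx

lemma exists_notMem_line (hdim : Module.finrank F H = 4) (L : Line F H) : ∃ k, k ∉ L.1 := by
  by_contra! h
  have := L.2
  rw [(Submodule.eq_top_iff'.2 h : L.1 = ⊤), finrank_top] at this
  omega

lemma line_mul_mem (hcenter : CenterEqF F H) (hdim : Module.finrank F H = 4) {L : Line F H}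
    (h1 : (1 : H) ∈ L.1) {x y : H} (hx : x ∈ L.1) (hy : y ∈ L.1) : x * y ∈ L.1 := by
  by_cases hxs : ∃ s : F, x = s • (1 : H)
  · obtain ⟨s, rfl⟩ := hxs
    simpa using L.1.smul_mem s hy
  push Not at hxs
  obtain ⟨a, b, rfl⟩ := (mem_line_iff h1 hx hxs y).1 hy
  obtain ⟨t, ⟨n, hn⟩, -⟩ := exists_isReducedTrace hcenter hdim x
  rw [mul_add, Algebra.mul_smul_comm, mul_one, Algebra.mul_smul_comm, hn]
  exact L.1.add_mem (L.1.smul_mem _ hx)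
    (L.1.smul_mem _ (L.1.sub_mem (L.1.smul_mem _ hx) (L.1.smul_mem _ h1)))

lemma line_inv_mem (hcenter : CenterEqF F H) (hdim : Module.finrank F H = 4) {L : Line F H}
    (h1 : (1 : H) ∈ L.1) {x : H} (hx : x ∈ L.1) : x⁻¹ ∈ L.1 := by
  by_cases hx0 : x = 0
  · simp [hx0]
  have : Module.Finite F L.1 := Module.finite_of_finrank_pos (by rw [L.2]; norm_num)
  let f : L.1 →ₗ[F] L.1 := (LinearMap.mulLeft F x).restrict fun _ hy =>
    line_mul_mem hcenter hdim h1 hx hy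
  have hf : Function.Injective f := fun y z h => by
    have := congrArg Subtype.val h
    exact Subtype.ext (mul_left_cancel₀ hx0 this)
  obtain ⟨y, hy⟩ := LinearMap.surjective_of_injective hf ⟨1, h1⟩
  have hy' : x * y = 1 := congrArg Subtype.val hy
  rw [inv_eq_of_mul_eq_one_right hy']
  exact y.2

/-- Multiplication of `H`, or the opposite multiplication. -/
def mulOrOp (H : Type*) [DivisionRing H] : Bool → H →+ H →+ H
  | true => AddMonoidHom.mul
  | false => AddMonoidHom.mul.flip

@[simp] lemma mulOrOp_true (x y : H) : mulOrOp H true x y = x * y := rfl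

@[simp] lemma mulOrOp_false (x y : H) : mulOrOp H false x y = y * x := rfl

lemma mem_line_of_mulOrOp_mem (hcenter : CenterEqF F H) (hdim : Module.finrank F H = 4)
    {L : Line F H} (h1 : (1 : H) ∈ L.1) (b : Bool) {x a : H} (ha : a ∈ L.1) (ha0 : a ≠ 0)
    (h : mulOrOp H b x a ∈ L.1) : x ∈ L.1 := by
  have hinv := line_inv_mem hcenter hdim h1 ha
  cases b
  · simpa [ha0] using line_mul_mem hcenter hdim h1 hinv h
  · simpa [ha0] using line_mul_mem hcenter hdim h1 h hinv

/-- A class of a Clifford-like parallelism consists of the translates, all on the same side,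
of its line through `1`. -/
lemma IsCliffordLike.exists_eq_translate (hcenter : CenterEqF F H)
    (hdim : Module.finrank F H = 4) {par : Line F H → Line F H → Prop}
    (hpar : IsCliffordLike F H par) {L : Line F H} (h1 : (1 : H) ∈ L.1) :
    ∃ b : Bool, ∀ N : Line F H, par N L → ∀ x ∈ N.1, x ≠ 0 →
      (N.1 : Set H) = mulOrOp H b x '' (L.1 : Set H) := by
  rcases hpar.2 L with h | h
  · refine ⟨true, fun N hN x hx hx0 => ?_⟩
    have hNL : N ∈ leftClass F H L := h ▸ hN
    obtain ⟨g, hg, hgL⟩ := hNL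
    have hmem : ∀ y, g * y ∈ L.1 ↔ y ∈ N.1 := fun y => by
      rw [← SetLike.mem_coe, hgL, (mul_right_injective₀ hg).mem_set_image, SetLike.mem_coe]
    ext y
    simp only [Set.mem_image, SetLike.mem_coe, mulOrOp_true]
    have hgx := (hmem x).2 hx
    refine ⟨fun hy => ⟨x⁻¹ * y, ?_, mul_inv_cancel_left₀ hx0 y⟩, ?_⟩
    · have := line_mul_mem hcenter hdim h1 (line_inv_mem hcenter hdim h1 hgx) ((hmem y).2 hy)
      rwa [mul_inv_rev, mul_assoc, inv_mul_cancel_left₀ hg] at this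
    · rintro ⟨l, hl, rfl⟩
      rw [← hmem, ← mul_assoc]
      exact line_mul_mem hcenter hdim h1 hgx hl
  · refine ⟨false, fun N hN x hx hx0 => ?_⟩
    have hNL : N ∈ rightClass F H L := h ▸ hN
    obtain ⟨g, hg, hgL⟩ := hNL
    have hmem : ∀ y, y * g ∈ L.1 ↔ y ∈ N.1 := fun y => by
      rw [← SetLike.mem_coe, hgL, (mul_left_injective₀ hg).mem_set_image, SetLike.mem_coe]
    ext y
    simp only [Set.mem_image, SetLike.mem_coe, mulOrOp_false]
    have hgx := (hmem x).2 hx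
    refine ⟨fun hy => ⟨y * x⁻¹, ?_, inv_mul_cancel_right₀ hx0 y⟩, ?_⟩
    · have := line_mul_mem hcenter hdim h1 ((hmem y).2 hy) (line_inv_mem hcenter hdim h1 hgx)
      rwa [mul_inv_rev, ← mul_assoc, mul_inv_cancel_right₀ hg] at this
    · rintro ⟨l, hl, rfl⟩
      rw [← hmem, mul_assoc]
      exact line_mul_mem hcenter hdim h1 hl hgx

/-- An additive map taking the translates `f g L` to the translates `f' (β g) L'` is compatible
with multiplication by the elements of `L`. -/
lemma map_translate {f f' : H →+ H →+ H} (hf : ∀ l, f 1 l = l) (hf' : ∀ l, f' 1 l = l)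
    {L L' : Submodule F H} (h1L : (1 : H) ∈ L) (hk : ∃ k, k ∉ L) {β : H → H}
    (hadd : ∀ x y, β (x + y) = β x + β y) (h1 : β 1 = 1) (hL : ∀ x, β x ∈ L' ↔ x ∈ L)
    (hind : ∀ x, ∀ a ∈ L', a ≠ 0 → f' x a ∈ L' → x ∈ L')
    (himg : ∀ g, g ≠ 0 → ∀ l ∈ L, ∃ a ∈ L', β (f g l) = f' (β g) a) (g : H) {l : H}
    (hl : l ∈ L) : β (f g l) = f' (β g) (β l) := by
  have key : ∀ g, g ∉ L → β (f g l) = f' (β g) (β l) := fun g hg => by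
    have hg0 : g ≠ 0 := fun h => hg (h ▸ L.zero_mem)
    have hg1 : g + 1 ≠ 0 := fun h => hg (by
      rw [eq_neg_of_add_eq_zero_left h]
      exact L.neg_mem h1L)
    obtain ⟨a, ha, hag⟩ := himg g hg0 l hl
    obtain ⟨b, hb, hbg⟩ := himg (g + 1) hg1 l hl
    have hc := (hL l).2 hl
    rw [map_add, AddMonoidHom.add_apply, hf, hadd, hadd, h1, map_add, AddMonoidHom.add_apply, hf',
      hag] at hbg
    have hdiff : f' (β g) (a - b) = b - β l := by
      rw [map_sub]
      linear_combination (norm := abel) hbg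
    have hab : a - b = 0 := by
      by_contra h0
      exact hg ((hL g).1 (hind _ _ (L'.sub_mem ha hb) h0 (hdiff ▸ L'.sub_mem hb hc)))
    rw [hab, map_zero] at hdiff
    rw [hag, sub_eq_zero.1 hab, sub_eq_zero.1 hdiff.symm]
  by_cases hg : g ∈ L
  · obtain ⟨k, hk⟩ := hk
    have hgk : g + k ∉ L := fun h => hk ((L.add_mem_iff_right hg).1 h)
    have := key _ hgk
    rw [map_add, AddMonoidHom.add_apply, hadd, hadd, map_add, AddMonoidHom.add_apply,
      key k hk] at this
    exact add_right_cancel this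
  · exact key g hg

lemma IsSemilinear.exists_image_line {β : H → H} (hβ : IsSemilinear F H β) (M : Line F H) :
    ∃ N : Line F H, (N.1 : Set H) = β '' (M.1 : Set H) := by
  obtain ⟨hbij, hadd, σ, hσ⟩ := hβ
  let β' : H →ₛₗ[(σ : F →+* F)] H := ⟨⟨β, hadd⟩, hσ⟩
  have : RingHomSurjective (σ : F →+* F) := ⟨σ.surjective⟩
  refine ⟨⟨M.1.map β', ?_⟩, rfl⟩
  let j : M.1 ≃+ M.1.map β' := AddEquiv.ofBijective
    (⟨⟨fun m => ⟨β m, m, m.2, rfl⟩, Subtype.ext (map_zero β')⟩,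
      fun x y => Subtype.ext (hadd x y)⟩ : M.1 →+ M.1.map β')
    ⟨fun x y h => Subtype.ext (hbij.1 (congrArg Subtype.val h)),
      fun ⟨_, m, hm, h⟩ => ⟨⟨m, hm⟩, Subtype.ext h⟩⟩
  have := rank_eq_of_equiv_equiv σ j σ.bijective fun r m => Subtype.ext (hσ r m)
  rw [Module.finrank, ← this]
  exact M.2

lemma IsSemilinear.comp {α β : H → H} (hα : IsSemilinear F H α) (hβ : IsSemilinear F H β) :
    IsSemilinear F H (α ∘ β) := by
  obtain ⟨hα1, hα2, σ, hα3⟩ := hα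
  obtain ⟨hβ1, hβ2, τ, hβ3⟩ := hβ
  refine ⟨hα1.comp hβ1, fun x y => ?_, τ.trans σ, fun a x => ?_⟩
  · simp [hα2, hβ2]
  · simp [hα3, hβ3]

lemma isSemilinear_mulLeft {g : H} (hg : g ≠ 0) : IsSemilinear F H (g * ·) :=
  ⟨mulLeft_bijective₀ g hg, mul_add g, RingEquiv.refl F, fun a x => by simp⟩

lemma Preserves.comp {par : Line F H → Line F H → Prop} {α β : H → H}
    (hα : Preserves F H α par) (hβ : Preserves F H β par) (hβs : IsSemilinear F H β) :
    Preserves F H (α ∘ β) par := fun M N M' N' hM hN => by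
  obtain ⟨M₁, hM₁⟩ := hβs.exists_image_line M
  obtain ⟨N₁, hN₁⟩ := hβs.exists_image_line N
  rw [hβ M N M₁ N₁ hM₁ hN₁]
  exact hα M₁ N₁ M' N' (by rw [hM, hM₁, Set.image_comp]) (by rw [hN, hN₁, Set.image_comp])

lemma preserves_leftPar {β : H → H} (hβ : Function.Bijective β) {b : H} (hb : b ≠ 0)
    (hmul : ∀ x y, β (x * y) = β x * b⁻¹ * β y) (h0 : β 0 = 0) :
    Preserves F H β (fun M N : Line F H => LeftPar F H M.1 N.1) := by
  intro M N M' N' hM hN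
  have himage : ∀ g, β '' ((fun m => g * m) '' (M.1 : Set H)) =
      (fun m => β g * b⁻¹ * m) '' (M'.1 : Set H) := fun g => by
    rw [hM, Set.image_image, Set.image_image]
    simp_rw [hmul]
  constructor
  · rintro ⟨g, hg, h⟩
    refine ⟨β g * b⁻¹, mul_ne_zero (h0 ▸ hβ.1.ne hg) (inv_ne_zero hb), ?_⟩
    rw [hN, h, himage]
  · rintro ⟨h, hh, hN'⟩
    obtain ⟨g, hg⟩ := hβ.2 (h * b)
    refine ⟨g, fun hg0 => mul_ne_zero hh hb (by rw [← hg, hg0, h0]), ?_⟩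
    apply hβ.1.image_injective
    rw [himage, hg, mul_inv_cancel_right₀ hb, ← hN, hN']

/-- A semilinear bijection that fixes `1` and preserves a Clifford-like parallelism is
multiplicative or antimultiplicative. -/
lemma mul_or_antimul_of_preserves (hcenter : CenterEqF F H) (hdim : Module.finrank F H = 4)
    {par : Line F H → Line F H → Prop} (hpar : IsCliffordLike F H par) {β : H → H}
    (hβ : IsSemilinear F H β) (h1 : β 1 = 1) (hpres : Preserves F H β par) :
    (∀ x y, β (x * y) = β x * β y) ∨ ∀ x y, β (x * y) = β y * β x := by
  have hinf := infinite_of_quaternion hcenter hdim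
  obtain ⟨hbij, hadd, σ, hσ⟩ := id hβ
  have h0 : β 0 = 0 := by simpa using hadd 0 0
  let A : Bool × Bool → Submodule F H := fun i =>
    { carrier := {l | ∀ g, β (mulOrOp H i.1 g l) = mulOrOp H i.2 (β g) (β l)}
      add_mem' := fun {x y} hx hy g => by rw [map_add, hadd, hx, hy, hadd, map_add]
      zero_mem' := fun g => by rw [map_zero, h0, map_zero]
      smul_mem' := fun a x hx g => by
        have hs : ∀ (b : Bool) (c : F) (u v : H), mulOrOp H b u (c • v) = c • mulOrOp H b u v := by
          rintro (_ | _) c u v <;> simp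
        rw [hs, hσ, hx, hσ, hs] }
  have hcover : ⋃ i, (A i : Set H) = Set.univ := by
    refine Set.eq_univ_of_forall fun l => Set.mem_iUnion.2 ?_
    obtain ⟨L, h1L, hlL⟩ := exists_line_one_mem hdim l
    obtain ⟨L', hL'⟩ := hβ.exists_image_line L
    have hmem : ∀ x, β x ∈ L'.1 ↔ x ∈ L.1 := fun x => by
      rw [← SetLike.mem_coe, hL', hbij.1.mem_set_image, SetLike.mem_coe]
    have h1L' : (1 : H) ∈ L'.1 := by rwa [← h1, hmem]
    obtain ⟨b, hb⟩ := hpar.exists_eq_translate hcenter hdim h1L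
    obtain ⟨b', hb'⟩ := hpar.exists_eq_translate hcenter hdim h1L'
    refine ⟨(b, b'), fun g => map_translate (fun l => ?_) (fun l => ?_) h1L
      (exists_notMem_line hdim L) hadd h1 hmem
      (fun x a => mem_line_of_mulOrOp_mem hcenter hdim h1L' b') (fun g hg l hl => ?_) g hlL⟩
    · cases b <;> simp
    · cases b' <;> simp
    · obtain ⟨N, ⟨hgN, hNL⟩, -⟩ := hpar.1.2 g hg L
      obtain ⟨N', hN'⟩ := hβ.exists_image_line N
      have hgN' : β g ∈ N'.1 := by
        rw [← SetLike.mem_coe, hN']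
        exact ⟨g, hgN, rfl⟩
      have hlN' : β (mulOrOp H b g l) ∈ (N'.1 : Set H) := by
        rw [hN', hb N hNL g hgN hg]
        exact ⟨_, ⟨l, hl, rfl⟩, rfl⟩
      rw [hb' N' ((hpres N L N' L' hN' hL').1 hNL) (β g) hgN' (h0 ▸ hbij.1.ne hg)] at hlN'
      obtain ⟨a, ha, h⟩ := hlN'
      exact ⟨a, ha, h.symm⟩
  obtain ⟨⟨b, b'⟩, htop⟩ := Subspace.exists_eq_top_of_iUnion_eq_univ hcover
  have hall : ∀ l g, β (mulOrOp H b g l) = mulOrOp H b' (β g) (β l) := fun l =>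
    (htop ▸ Submodule.mem_top : l ∈ A (b, b'))
  cases b <;> cases b' <;> simp only [mulOrOp_true, mulOrOp_false] at hall
  · exact Or.inl hall
  · exact Or.inr hall
  · exact Or.inr fun x y => hall y x
  · exact Or.inl fun x y => hall y x

/-- No line through `1` is normalized by all of `H`. -/
lemma exists_translate_ne (hcenter : CenterEqF F H) (hdim : Module.finrank F H = 4)
    {L : Line F H} (h1L : (1 : H) ∈ L.1) :
    ∃ x : H, x ≠ 0 ∧
      mulOrOp H true x '' (L.1 : Set H) ≠ mulOrOp H false x '' (L.1 : Set H) := by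
  by_contra! h
  have hcomm : ∀ g, ∀ l ∈ L.1, g * l = l * g := fun g l hl =>
    map_translate (f := mulOrOp H true) (f' := mulOrOp H false) (β := id) (L' := L.1)
      (by simp) (by simp) h1L (exists_notMem_line hdim L) (fun _ _ => rfl) rfl (fun _ => Iff.rfl)
      (fun x a => mem_line_of_mulOrOp_mem hcenter hdim h1L false)
      (fun g hg l hl => by
        have : mulOrOp H true g l ∈ mulOrOp H true g '' (L.1 : Set H) := ⟨l, hl, rfl⟩
        rw [h g hg] at this
        obtain ⟨a, ha, hag⟩ := this
        exact ⟨a, ha, hag.symm⟩) g hl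
  have hle : L.1 ≤ Submodule.span F {1} := fun l hl => by
    obtain ⟨a, rfl⟩ := scalar_of_central hcenter fun g => (hcomm g l hl).symm
    exact Submodule.smul_mem _ _ (Submodule.mem_span_singleton_self _)
  have := Submodule.finrank_mono hle
  rw [L.2, finrank_span_singleton one_ne_zero] at this
  omega

/-- Conjugation interchanges the left and right classes, so an antimultiplicative bijection cannot
preserve a Clifford-like parallelism that all multiplicative ones preserve. -/
lemma not_antimul_of_preserves (hcenter : CenterEqF F H) (hdim : Module.finrank F H = 4)
    {par : Line F H → Line F H → Prop} (hpar : IsCliffordLike F H par)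
    (hsub : ∀ β : H → H, IsSemilinear F H β →
      Preserves F H β (fun M N : Line F H => LeftPar F H M.1 N.1) → Preserves F H β par)
    {β : H → H} (hβ : IsSemilinear F H β) (hpres : Preserves F H β par) :
    ¬ ∀ x y, β (x * y) = β y * β x := by
  intro hanti
  obtain ⟨κ, hinv, hκadd, hκsmul, hκmul, hκ⟩ := exists_conjugation hcenter hdim
  have hκs : IsSemilinear F H κ := ⟨hinv.bijective, hκadd, RingEquiv.refl F, hκsmul⟩
  have hκ0 : κ 0 = 0 := by simpa using hκadd 0 0
  have hβ0 : β 0 = 0 := by simpa using hβ.2.1 0 0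
  have hβκ : Preserves F H (β ∘ κ) par := hsub _ (hβ.comp hκs) <|
    preserves_leftPar (hβ.comp hκs).1 one_ne_zero
      (fun x y => by simp [hκmul, hanti]) (by simp [hκ0, hβ0])
  obtain ⟨L, h1L, -⟩ := exists_line_one_mem (F := F) hdim (1 : H)
  have hκL : ∀ x ∈ L.1, κ x ∈ L.1 := fun x hx => by
    obtain ⟨t, ht⟩ := hκ x
    rw [ht]
    exact L.1.sub_mem (L.1.smul_mem t h1L) hx
  have himgL : (L.1 : Set H) = κ '' (L.1 : Set H) :=
    Set.Subset.antisymm (fun x hx => ⟨κ x, hκL x hx, hinv x⟩) (Set.image_subset_iff.2 hκL)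
  obtain ⟨L', hL'⟩ := hβ.exists_image_line L
  have hclass : ∀ N N' : Line F H, (N'.1 : Set H) = κ '' (N.1 : Set H) → par N L → par N' L := by
    intro N N' hN' hNL
    obtain ⟨N'', hN''⟩ := hβ.exists_image_line N'
    rw [hpres N' L N'' L' hN'' hL']
    refine (hβκ N L N'' L' ?_ ?_).1 hNL
    · rw [hN'', hN', Set.image_comp]
    · rw [hL', Set.image_comp, ← himgL]
  obtain ⟨b, hb⟩ := hpar.exists_eq_translate hcenter hdim h1L
  obtain ⟨x, hx, hne⟩ := exists_translate_ne hcenter hdim h1L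
  have hκx : κ x ≠ 0 := hκ0 ▸ hinv.injective.ne hx
  obtain ⟨N, ⟨hxN, hNL⟩, -⟩ := hpar.1.2 (κ x) hκx L
  obtain ⟨N', hN'⟩ := hκs.exists_image_line N
  have hxN' : x ∈ N'.1 := by
    rw [← SetLike.mem_coe, hN']
    exact ⟨κ x, hxN, hinv x⟩
  have h := hb N' (hclass N N' hN' hNL) x hxN' hx
  have hop : ∀ l, κ (mulOrOp H b (κ x) l) = mulOrOp H (!b) x (κ l) := fun l => by
    cases b <;> simp [hκmul, hinv x]
  rw [hN', hb N hNL (κ x) hxN hκx, Set.image_image] at h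
  simp_rw [hop] at h
  rw [← Set.image_image (mulOrOp H (!b) x) κ, ← himgL] at h
  cases b
  · exact hne h
  · exact hne h.symm

end Quaternion

/-- The automorphism group of a Clifford-like parallelism `∥` cannot properly contain
that of `∥ℓ`: if every semilinear bijection preserving `∥ℓ` preserves `∥`, then every
semilinear bijection preserving `∥` preserves `∥ℓ`. -/
theorem no_proper_containment
    (hcenter : CenterEqF F H) (hdim : Module.finrank F H = 4)
    (par : Line F H → Line F H → Prop) (hpar : IsCliffordLike F H par)
    (hsub : ∀ β : H → H, IsSemilinear F H β →
      Preserves F H β (fun M N : Line F H => LeftPar F H M.1 N.1) →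
      Preserves F H β par) :
    ∀ β : H → H, IsSemilinear F H β → Preserves F H β par →
      Preserves F H β (fun M N : Line F H => LeftPar F H M.1 N.1) := by
  intro β hβ hpres
  have hβ0 : β 0 = 0 := by simpa using hβ.2.1 0 0
  have hb : β 1 ≠ 0 := hβ0 ▸ hβ.1.1.ne one_ne_zero
  have hb' : (β 1)⁻¹ ≠ 0 := inv_ne_zero hb
  have htrans := isSemilinear_mulLeft (F := F) hb'
  have htranspres : Preserves F H ((β 1)⁻¹ * ·) par := hsub _ htrans <|
    preserves_leftPar htrans.1 hb' (fun x y => by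
      rw [inv_inv, mul_assoc, mul_assoc, mul_inv_cancel_left₀ hb]) (mul_zero _)
  have hα : IsSemilinear F H (((β 1)⁻¹ * ·) ∘ β) := htrans.comp hβ
  have hαpres := htranspres.comp hpres hβ
  rcases mul_or_antimul_of_preserves hcenter hdim hpar hα (inv_mul_cancel₀ hb) hαpres with h | h
  · refine preserves_leftPar hβ.1 hb (fun x y => ?_) hβ0
    apply mul_left_cancel₀ hb'
    simpa [mul_assoc] using h x y
  · exact absurd h (not_antimul_of_preserves hcenter hdim hpar hsub hα hαpres)
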